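/- Let r_i be a rule of a program P with Adv(r_i) ≠ ∅, let β be a blanket for Adv(r_i), let λ ∈ Neg(β), let r'_i be the λ-extended rule (H(r'_i) = H(r_i), B(r'_i) = B(r_i) ∪ λ), and let P' = (P \ {r_i}) ∪ {r'_i}. Then the conflict resolution step strictly decreases the set of conflicts: under the identification of r'_i with r_i, Confl(P') is a proper subset of Confl(P). -/

import Mathlib

/-! ## Classical and extended literals -/

/-- A classical literal over atoms `A`: an atom `a` (positive) or a strongly
negated atom `¬a` (negative). -/
inductive CLit (A : Type) : Type
  | pos : A → CLit A
  | neg : A → CLit A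
deriving DecidableEq

namespace CLit

/-- The strong complement of a classical literal. -/
def compl {A : Type} : CLit A → CLit A
  | pos a => neg a
  | neg a => pos a

/-- The underlying atom of a classical literal. -/
def atom {A : Type} : CLit A → A
  | pos a => a
  | neg a => a

end CLit

/-- Two classical literals are strongly complementary. -/
def StronglyComp {A : Type} (L L' : CLit A) : Prop := L' = L.compl

/-- A set of classical literals is consistent iff it contains no strongly
complementary pair. -/
def Consistent {A : Type} (S : Set (CLit A)) : Prop := ∀ L ∈ S, L.compl ∉ S

/-- An extended literal: a classical literal `L` or a default-negated
classical literal `not L`. -/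
inductive ELit (A : Type) : Type
  | lit : CLit A → ELit A
  | not : CLit A → ELit A
deriving DecidableEq

namespace ELit

/-- The underlying atom of an extended literal. -/
def atom {A : Type} : ELit A → A
  | lit L => L.atom
  | not L => L.atom

end ELit

/-- Two extended literals are atom-related iff they have the same underlying atom. -/
def AtomRelated {A : Type} (e e' : ELit A) : Prop := e.atom = e'.atom

/-- Strongly complementary extended literals: `L` and its strong complement. -/
def EStrComp {A : Type} (e e' : ELit A) : Prop :=
  ∃ L : CLit A, e = ELit.lit L ∧ e' = ELit.lit L.compl

/-- Default complementary extended literals: `L` and `not L`. -/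
def EDefComp {A : Type} (e e' : ELit A) : Prop :=
  ∃ L : CLit A, (e = ELit.lit L ∧ e' = ELit.not L) ∨ (e = ELit.not L ∧ e' = ELit.lit L)

/-- Complementary extended literals: strongly or default complementary. -/
def EComp {A : Type} (e e' : ELit A) : Prop := EStrComp e e' ∨ EDefComp e e'

/-- Dual extended literals: `L` and `not (strong complement of L)`. -/
def EDual {A : Type} (e e' : ELit A) : Prop :=
  ∃ L : CLit A, (e = ELit.lit L ∧ e' = ELit.not L.compl) ∨ (e = ELit.not L.compl ∧ e' = ELit.lit L)

/-- Reconcilable extended literals: `not L` and `not (strong complement of L)`. -/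
def EReconc {A : Type} (e e' : ELit A) : Prop :=
  ∃ L : CLit A, e = ELit.not L ∧ e' = ELit.not L.compl

/-- Satisfaction of an extended literal by a set of classical literals:
`S ⊨ L` iff `L ∈ S`, and `S ⊨ not L` iff `L ∉ S`. -/
def SatE {A : Type} (S : Set (CLit A)) : ELit A → Prop
  | ELit.lit L => L ∈ S
  | ELit.not L => L ∉ S

/-- A set `S` of classical literals satisfies a set `X` of extended literals
iff it satisfies every element of `X`. -/
def SatAll {A : Type} (S : Set (CLit A)) (X : Set (ELit A)) : Prop := ∀ e ∈ X, SatE S e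

/-! ## Rules and programs -/

/-- A rule: a head (a classical literal) and a finite body of extended literals. -/
structure Rule (A : Type) where
  head : CLit A
  body : Finset (ELit A)

/-- The classical literals occurring positively in the body, `B⁺(r)`. -/
def Rule.bodyPos {A : Type} (r : Rule A) : Set (CLit A) := {L | ELit.lit L ∈ r.body}

/-- The classical literals occurring default-negated in the body, `B⁻(r)`. -/
def Rule.bodyNeg {A : Type} (r : Rule A) : Set (CLit A) := {L | ELit.not L ∈ r.body}

/-- A rule is applicable iff some consistent set of classical literals
satisfies its body. -/
def Applicable {A : Type} (r : Rule A) : Prop :=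
  ∃ S : Set (CLit A), Consistent S ∧ SatAll S ↑r.body

/-- Two rules `r ≠ r'` are conflicting iff their heads are strongly complementary
and some consistent set of classical literals satisfies both bodies. -/
def Conflicting {A : Type} (r r' : Rule A) : Prop :=
  r ≠ r' ∧ StronglyComp r.head r'.head ∧
    ∃ S : Set (CLit A), Consistent S ∧ SatAll S ↑r.body ∧ SatAll S ↑r'.body

/-! ## Answer set semantics -/

/-- `S` is a model of the positive parts: for each rule, the head is in `S`
whenever the positive body is contained in `S`. -/
def PModel {A : Type} (P : Set (Rule A)) (S : Set (CLit A)) : Prop :=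
  ∀ r ∈ P, r.bodyPos ⊆ S → r.head ∈ S

/-- The least model of a program without default negation. -/
def leastModel {A : Type} (P : Set (Rule A)) : Set (CLit A) := ⋂₀ {S | PModel P S}

open Classical in
/-- The answer set of a program without default negation: the least model if it
is consistent, and the set `Lit_A` of all classical literals otherwise. -/
noncomputable def posAnswerSet {A : Type} (P : Set (Rule A)) : Set (CLit A) :=
  if Consistent (leastModel P) then leastModel P else Set.univ

/-- Whether an extended literal is a (positive occurrence of a) classical literal. -/
def ELit.isPos {A : Type} : ELit A → Bool
  | ELit.lit _ => true
  | ELit.not _ => false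

/-- The reduct `P^S`: keep the rules with `B⁻(r) ∩ S = ∅`, as `H(r) ← B⁺(r)`. -/
def reduct {A : Type} (P : Set (Rule A)) (S : Set (CLit A)) : Set (Rule A) :=
  {r' | ∃ r ∈ P, r.bodyNeg ∩ S = ∅ ∧ r' = ⟨r.head, r.body.filter (fun e => e.isPos)⟩}

/-- `S` is an answer set of `P` iff `S` is the answer set of the reduct `P^S`. -/
def AnswerSet {A : Type} (P : Set (Rule A)) (S : Set (CLit A)) : Prop :=
  S = posAnswerSet (reduct P S)

/-- The fact corresponding to a classical literal: a rule with empty body. -/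
def fact {A : Type} (L : CLit A) : Rule A := ⟨L, ∅⟩

/-! ## Blankets and the negation operator -/

/-- The adversarial rules of `r` in the program `P`. -/
def Adv {A : Type} (P : Set (Rule A)) (r : Rule A) : Set (Rule A) :=
  {r' ∈ P | Conflicting r r'}

/-- The negation operator on extended literals:
`neg a = {not a, ¬a}`, `neg ¬a = {not ¬a, a}`, `neg (not a) = {a}`, `neg (not ¬a) = {¬a}`. -/
def negE {A : Type} : ELit A → Set (ELit A)
  | ELit.lit L => {ELit.not L, ELit.lit L.compl}
  | ELit.not L => {ELit.lit L}

/-- `neg(e, X) = ⋂ {neg k : k ∈ X, k atom-related to e}`. -/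
def negDep {A : Type} (e : ELit A) (X : Set (ELit A)) : Set (ELit A) :=
  ⋂ k ∈ {k ∈ X | AtomRelated k e}, negE k

/-- `Neg(X)`: all sets `T` of extended literals containing exactly one element of
each nonempty set `neg(e, X)` for `e ∈ X`, and nothing else. -/
def NegSets {A : Type} (X : Set (ELit A)) : Set (Set (ELit A)) :=
  {T | (∀ e ∈ X, (negDep e X).Nonempty → ∃! t, t ∈ T ∧ t ∈ negDep e X) ∧
       (∀ t ∈ T, ∃ e ∈ X, t ∈ negDep e X)}

/-- All blanket conditions except `⊆`-minimality: nonempty, no complementary pair,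
no reconcilable pair, atoms disjoint from the atoms of `B(r)`, and meeting the body
of every adversarial rule of `r`. -/
def PreBlanket {A : Type} (P : Set (Rule A)) (r : Rule A) (β : Set (ELit A)) : Prop :=
  β.Nonempty ∧
  (∀ e ∈ β, ∀ e' ∈ β, ¬ EComp e e') ∧
  (∀ e ∈ β, ∀ e' ∈ β, ¬ EReconc e e') ∧
  (∀ e ∈ β, ∀ e' ∈ r.body, e.atom ≠ ELit.atom e') ∧
  (∀ rj ∈ Adv P r, ∃ e ∈ β, e ∈ rj.body)

/-- A blanket for `Adv(r)` (with ambient program `P`): a `⊆`-minimal set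
satisfying the blanket conditions. -/
def Blanket {A : Type} (P : Set (Rule A)) (r : Rule A) (β : Set (ELit A)) : Prop :=
  PreBlanket P r β ∧ ∀ β' ⊆ β, PreBlanket P r β' → β' = β

open Classical

theorem CLit.compl_compl {A : Type} (L : CLit A) : L.compl.compl = L := by
  cases L <;> rfl

theorem CLit.eq_or_eq_compl_of_atom_eq {A : Type} {L M : CLit A} (h : L.atom = M.atom) :
    L = M ∨ L = M.compl := by
  cases L <;> cases M <;> simp_all [CLit.atom, CLit.compl]

theorem Conflicting.symm {A : Type} {r s : Rule A} (h : Conflicting r s) : Conflicting s r := by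
  obtain ⟨hne, hhead, S, hS, hr, hs⟩ := h
  refine ⟨hne.symm, ?_, S, hS, hs, hr⟩
  unfold StronglyComp at *
  rw [hhead, CLit.compl_compl]

/-- No consistent set satisfies both an extended literal and one of its negations. -/
theorem not_satE_of_mem_negE {A : Type} {S : Set (CLit A)} (hS : Consistent S) {e t : ELit A}
    (ht : t ∈ negE e) (he : SatE S e) : ¬ SatE S t := by
  cases e with
  | lit L =>
    rcases ht with rfl | rfl
    · exact fun h => h he
    · exact hS L he
  | not L =>
    cases ht
    exact he

/-- Without complementary or reconcilable pairs, every dependent negation is nonempty. -/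
theorem negDep_nonempty {A : Type} {X : Set (ELit A)}
    (hcomp : ∀ e ∈ X, ∀ e' ∈ X, ¬ EComp e e') (hrec : ∀ e ∈ X, ∀ e' ∈ X, ¬ EReconc e e')
    {e : ELit A} (he : e ∈ X) : (negDep e X).Nonempty := by
  cases e with
  | lit L =>
    refine ⟨ELit.lit L.compl, Set.mem_iInter₂.2 ?_⟩
    rintro (K | K) ⟨hk, hrel⟩ <;>
      rcases CLit.eq_or_eq_compl_of_atom_eq (L := K) (M := L) hrel with rfl | rfl
    · exact Or.inr rfl
    · exact (hcomp _ he _ hk (Or.inl ⟨L, rfl, rfl⟩)).elim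
    · exact (hcomp _ he _ hk (Or.inr ⟨K, Or.inl ⟨rfl, rfl⟩⟩)).elim
    · exact rfl
  | not L =>
    refine ⟨ELit.lit L, Set.mem_iInter₂.2 ?_⟩
    rintro (K | K) ⟨hk, hrel⟩ <;>
      rcases CLit.eq_or_eq_compl_of_atom_eq (L := K) (M := L) hrel with rfl | rfl
    · exact (hcomp _ he _ hk (Or.inr ⟨K, Or.inr ⟨rfl, rfl⟩⟩)).elim
    · exact Or.inr (congrArg ELit.lit (CLit.compl_compl L).symm)
    · exact rfl
    · exact (hrec _ he _ hk ⟨L, rfl, rfl⟩).elim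

/-- A rule extended by an element of `Neg(β)`, for `β` satisfying the blanket conditions,
conflicts with no rule of the program. -/
theorem PreBlanket.not_conflicting_extension {A : Type} [DecidableEq A] {P : Set (Rule A)}
    {r r' s : Rule A} {β : Set (ELit A)} (hβ : PreBlanket P r β) {lam : Finset (ELit A)}
    (hlam : (↑lam : Set (ELit A)) ∈ NegSets β) (hhead : r'.head = r.head)
    (hbody : r'.body = r.body ∪ lam) (hs : s ∈ P) : ¬ Conflicting r' s := by
  rintro ⟨-, hc, S, hS, hr', hsat⟩
  obtain ⟨-, hcomp, hrec, -, hcover⟩ := hβ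
  have hc' : s.head = r.head.compl := by rw [← hhead]; exact hc
  have hne : r ≠ s := by
    rintro rfl
    cases h : r.head <;> rw [h] at hc' <;> cases hc'
  have hr : SatAll S ↑r.body := fun e he => hr' e (by
    rw [hbody]; exact Finset.mem_union_left _ he)
  obtain ⟨e, heβ, hes⟩ := hcover s ⟨hs, hne, hc', S, hS, hr, hsat⟩
  obtain ⟨t, ⟨htlam, htneg⟩, -⟩ := hlam.1 e heβ (negDep_nonempty hcomp hrec heβ)
  have hte : t ∈ negE e := Set.mem_iInter₂.1 htneg e ⟨heβ, rfl⟩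
  refine not_satE_of_mem_negE hS hte (hsat e hes) (hr' t ?_)
  rw [hbody]
  exact Finset.mem_union_right _ htlam

/-- If `Adv(r_i) ≠ ∅`, `β` is a blanket for `Adv(r_i)`,
`λ ∈ Neg(β)`, and `P' = (P \ {r_i}) ∪ {r'_i}` with `r'_i` the λ-extended rule, then,
identifying `r'_i` with `r_i`, the conflicts of `P'` form a proper subset of the
conflicts of `P`: every conflict of `P'` maps to a conflict of `P`, and some conflict
of `P` is not the image of any conflict of `P'`. -/
theorem stmt_13 {A : Type} [DecidableEq A]
    (P : Set (Rule A)) (ri : Rule A) (hri : ri ∈ P)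
    (hadv : ∃ rj ∈ P, Conflicting ri rj)
    (β : Set (ELit A)) (hβ : Blanket P ri β)
    (lam : Finset (ELit A)) (hlam : (↑lam : Set (ELit A)) ∈ NegSets β)
    (ri' : Rule A) (hhead : ri'.head = ri.head) (hbody : ri'.body = ri.body ∪ lam) :
    (∀ r ∈ (P \ {ri}) ∪ {ri'}, ∀ s ∈ (P \ {ri}) ∪ {ri'}, Conflicting r s →
      (if r = ri' then ri else r) ∈ P ∧ (if s = ri' then ri else s) ∈ P ∧
      Conflicting (if r = ri' then ri else r) (if s = ri' then ri else s)) ∧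
    (∃ r ∈ P, ∃ s ∈ P, Conflicting r s ∧
      ¬ ∃ r' ∈ (P \ {ri}) ∪ {ri'}, ∃ s' ∈ (P \ {ri}) ∪ {ri'}, Conflicting r' s' ∧
        (if r' = ri' then ri else r') = r ∧ (if s' = ri' then ri else s') = s) := by
  have hnc : ∀ s ∈ (P \ {ri}) ∪ {ri'}, ¬ Conflicting ri' s := by
    rintro s (hs | rfl) h
    · exact hβ.1.not_conflicting_extension hlam hhead hbody hs.1 h
    · exact h.1 rfl
  obtain ⟨rj, hrj, hconf⟩ := hadv
  have hne : ri ≠ ri' := by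
    rintro rfl
    exact hβ.1.not_conflicting_extension hlam hhead hbody hrj hconf
  refine ⟨fun r hr s hs h => ?_, ri, hri, rj, hrj, hconf, ?_⟩
  · have hrne : r ≠ ri' := by
      rintro rfl
      exact hnc s hs h
    have hsne : s ≠ ri' := by
      rintro rfl
      exact hnc r hr h.symm
    rw [if_neg hrne, if_neg hsne]
    exact ⟨(hr.resolve_right hrne).1, (hs.resolve_right hsne).1, h⟩
  · rintro ⟨r', hr', s', hs', h, hr'i, -⟩
    have hrne : r' ≠ ri' := by
      rintro rfl
      exact hnc s' hs' h
    rw [if_neg hrne] at hr'i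
    exact (hr'.resolve_right hrne).2 hr'i
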